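/- Let X be a metric space, r > 0 a real number, S₁ ⊆ X a set whose distinct elements are pairwise at distance strictly greater than 3r, and f : X → X a function with 0 < dist x (f x) ≤ r for every x ∈ S₁. Let S = S₁ ∪ f '' S₁. Then every element of S has exactly one r-neighbor in S other than itself; explicitly, for every x ∈ S₁ the set {y ∈ S : y ≠ x ∧ dist x y ≤ r} equals {f x}, and the set {y ∈ S : y ≠ f x ∧ dist (f x) y ≤ r} equals {x}. -/

import Mathlib

/-- In the construction where the points of `S₁` are pairwise more than `3r`
apart and `f x` is a point with `0 < dist x (f x) ≤ r`, every element of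
`S = S₁ ∪ f '' S₁` has exactly one `r`-neighbor in `S` other than itself:
for `x ∈ S₁` the `r`-neighbors of `x` (other than `x`) in `S` are exactly
`{f x}`, and the `r`-neighbors of `f x` (other than `f x`) in `S` are
exactly `{x}`. -/
theorem unique_r_neighbor {X : Type*} [MetricSpace X] (r : ℝ) (hr : 0 < r)
    (S₁ : Set X)
    (hsep : ∀ x ∈ S₁, ∀ y ∈ S₁, x ≠ y → 3 * r < dist x y)
    (f : X → X)
    (hf : ∀ x ∈ S₁, 0 < dist x (f x) ∧ dist x (f x) ≤ r) :
    ∀ x ∈ S₁,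
      {y | y ∈ S₁ ∪ f '' S₁ ∧ y ≠ x ∧ dist x y ≤ r} = {f x} ∧
      {y | y ∈ S₁ ∪ f '' S₁ ∧ y ≠ f x ∧ dist (f x) y ≤ r} = {x} := by
  intro x hx
  obtain ⟨hpos, hle⟩ := hf x hx
  have eq_of_dist_le : ∀ z ∈ S₁, dist x z ≤ 3 * r → z = x := fun z hz h ↦ by
    by_contra hne
    exact (hsep x hx z hz (Ne.symm hne)).not_ge h
  constructor
  · ext y
    simp only [Set.mem_ofPred_eq, Set.mem_singleton_iff]
    constructor
    · rintro ⟨hy | ⟨z, hz, rfl⟩, hne, hd⟩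
      · exact absurd (eq_of_dist_le y hy (by linarith)) hne
      · rw [eq_of_dist_le z hz (by linarith [dist_triangle_right x z (f z), (hf z hz).2])]
    · rintro rfl
      exact ⟨Or.inr ⟨x, hx, rfl⟩, (dist_pos.mp hpos).symm, hle⟩
  · ext y
    simp only [Set.mem_ofPred_eq, Set.mem_singleton_iff]
    constructor
    · rintro ⟨hy | ⟨z, hz, rfl⟩, hne, hd⟩
      · exact eq_of_dist_le y hy (by linarith [dist_triangle x (f x) y])
      · have hzx : z = x := eq_of_dist_le z hz (by
          linarith [dist_triangle x (f x) (f z), dist_triangle_right x z (f z), (hf z hz).2])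
        exact absurd (congrArg f hzx) hne
    · rintro rfl
      exact ⟨Or.inl hx, dist_pos.mp hpos, by rwa [dist_comm]⟩
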